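/- arXiv:1002.1679 — 2 statements merged into one kernel-verified Lean document; each statement's English description precedes it below -/
import Mathlib

section
/- The intersection of the Lucas sequences U_n(3,-1) and U_n(6,1) is {0, 1, 1189}; that is, {U_n(3,-1) : n >= 0} ∩ {U_m(6,1) : m >= 0} = {0, 1, 1189}. -/
/-- Lucas sequence of the first kind: `U 0 = 0`, `U 1 = 1`,
`U (n+2) = P * U (n+1) - Q * U n`. -/
def lucasU (P Q : ℤ) : ℕ → ℤ
  | 0 => 0
  | 1 => 1
  | n + 2 => P * lucasU P Q (n + 1) - Q * lucasU P Q n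

/-- Lucas sequence of the second kind: `V 0 = 2`, `V 1 = P`,
`V (n+2) = P * V (n+1) - Q * V n`. -/
def lucasV (P Q : ℤ) : ℕ → ℤ
  | 0 => 2
  | 1 => P
  | n + 2 => P * lucasV P Q (n + 1) - Q * lucasV P Q n

open Polynomial NumberTheorySymbols

/-- The Chebyshev value `T_n(17)`, equal to `(α ^ n + α ^ (-n)) / 2` with `α = 17 + 12 √2`. -/
noncomputable def cheb (n : ℤ) : ℤ := (Chebyshev.T ℤ n).eval 17

theorem cheb_zero : cheb 0 = 1 := by simp [cheb]

theorem cheb_one : cheb 1 = 17 := by simp [cheb]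

theorem cheb_neg (n : ℤ) : cheb (-n) = cheb n := by simp [cheb]

theorem two_mul_cheb_mul_cheb (m k : ℤ) : 2 * cheb m * cheb k = cheb (m + k) + cheb (m - k) := by
  simpa [cheb] using congrArg (eval 17) (Chebyshev.T_mul_T ℤ m k)

theorem cheb_add_two (n : ℤ) : cheb (n + 2) = 34 * cheb (n + 1) - cheb n := by
  have h := two_mul_cheb_mul_cheb (n + 1) 1
  rw [cheb_one, show n + 1 + 1 = n + 2 by ring, show n + 1 - 1 = n by ring] at h
  linarith

theorem cheb_two_mul (n : ℤ) : cheb (2 * n) = 2 * cheb n ^ 2 - 1 := by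
  have h := two_mul_cheb_mul_cheb n n
  rw [sub_self, cheb_zero, ← two_mul] at h
  linarith

theorem cheb_two_mul_add_one (n : ℤ) : cheb (2 * n + 1) = 2 * cheb n * cheb (n + 1) - 17 := by
  have h := two_mul_cheb_mul_cheb (n + 1) n
  rw [show n + 1 - n = 1 by ring, cheb_one, show n + 1 + n = 2 * n + 1 by ring] at h
  linarith

/-- Shifting the index by an odd multiple of `2 * j` negates `cheb` modulo `cheb j`. -/
theorem cheb_dvd_add (n j : ℤ) {g : ℤ} (hg : Odd g) :
    cheb j ∣ cheb (n + 2 * j * g) + cheb n := by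
  have anti : Function.Antiperiodic (fun m => (cheb m : ZMod (cheb j).natAbs)) (2 * j) := by
    intro m
    have h := two_mul_cheb_mul_cheb (m + j) j
    rw [show m + j + j = m + 2 * j by ring, show m + j - j = m by ring] at h
    have h0 : ((cheb (m + 2 * j) + cheb m : ℤ) : ZMod (cheb j).natAbs) = 0 := by
      rw [ZMod.intCast_zmod_eq_zero_iff_dvd, Int.natCast_natAbs, abs_dvd, ← h]
      exact dvd_mul_left _ _
    push_cast at h0
    exact eq_neg_of_add_eq_zero_left h0
  obtain ⟨h, rfl⟩ := hg
  have h1 : (cheb (n + 2 * j * (2 * h + 1)) : ZMod (cheb j).natAbs) = -cheb n := by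
    have h2 := anti.periodic_two_mul.int_mul h (n + 2 * j)
    have h3 := anti n
    simp only at h2 h3
    rw [← h3, ← h2]
    congr 2
    push_cast
    ring
  rw [← abs_dvd, ← Int.natCast_natAbs, ← ZMod.intCast_zmod_eq_zero_iff_dvd]
  push_cast
  rw [h1, neg_add_cancel]

/-- The pair `(cheb k, cheb (k + 1))` modulo `p`, for `k < 2 ^ fuel`, by repeated doubling. -/
def chebMod (p : ℕ) : ℕ → ℕ → ℕ × ℕ
  | 0, _ => (1, 17)
  | f + 1, k =>
    (fun ab : ℕ × ℕ =>
      if k % 2 = 0 then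
        ((2 * ab.1 * ab.1 + (p - 1)) % p, (2 * ab.1 * ab.2 + 17 * (p - 1)) % p)
      else
        ((2 * ab.1 * ab.2 + 17 * (p - 1)) % p, (2 * ab.2 * ab.2 + (p - 1)) % p))
      (chebMod p f (k / 2))

theorem chebMod_spec {p : ℕ} (hp : 0 < p) (f k : ℕ) (hk : k < 2 ^ f) :
    ((chebMod p f k).1 : ZMod p) = cheb k ∧ ((chebMod p f k).2 : ZMod p) = cheb (k + 1) := by
  have hpred : ((p - 1 : ℕ) : ZMod p) = -1 := by
    rw [Nat.cast_sub hp]; simp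
  induction f generalizing k with
  | zero =>
    obtain rfl : k = 0 := by simpa using hk
    simp [chebMod, cheb_zero, cheb_one]
  | succ f ih =>
    obtain ⟨h1, h2⟩ := ih (k / 2) (by rw [pow_succ] at hk; lia)
    rcases Nat.even_or_odd' k with ⟨c, rfl | rfl⟩
    · have hc : 2 * c / 2 = c := by lia
      rw [hc] at h1 h2
      simp only [chebMod, hc, Nat.mul_mod_right, if_true, ZMod.natCast_mod]
      push_cast
      rw [hpred, h1, h2, cheb_two_mul, cheb_two_mul_add_one]
      push_cast
      constructor <;> ring
    · have hc : (2 * c + 1) / 2 = c := by lia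
      have hodd : ¬ (2 * c + 1) % 2 = 0 := by lia
      rw [hc] at h1 h2
      simp only [chebMod, hc, hodd, if_false, ZMod.natCast_mod]
      push_cast
      rw [hpred, h1, h2, cheb_two_mul_add_one, show (2 * c + 1 + 1 : ℤ) = 2 * (c + 1) by ring,
        cheb_two_mul]
      push_cast
      constructor <;> ring

/-- `b` is a period of `cheb` modulo the odd prime `p`. -/
def IsPeriod (p b : ℕ) : Prop :=
  p.Prime ∧ p ≠ 2 ∧ 0 < b ∧ b < 2 ^ 17 ∧
    (chebMod p 17 b).1 % p = 1 % p ∧ (chebMod p 17 b).2 % p = 17 % p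

theorem IsPeriod.periodic {p b : ℕ} (h : IsPeriod p b) :
    Function.Periodic (fun m => (cheb m : ZMod p)) b := by
  obtain ⟨hp, -, -, hb, h1, h2⟩ := h
  obtain ⟨e1, e2⟩ := chebMod_spec hp.pos 17 b hb
  rw [(ZMod.natCast_eq_natCast_iff' _ _ _).2 h1] at e1
  rw [(ZMod.natCast_eq_natCast_iff' _ _ _).2 h2] at e2
  intro m
  simp only
  induction m using Chebyshev.induct with
  | zero => simp [← e1, cheb_zero]
  | one => rw [add_comm, ← e2, cheb_one]; simp
  | add_two n ih1 ih2 =>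
    rw [show (n : ℤ) + 2 + b = n + b + 2 by ring, cheb_add_two, cheb_add_two,
      show (n : ℤ) + b + 1 = n + 1 + b by ring]
    push_cast
    rw [ih1, ih2]
  | neg_add_one n ih1 ih2 =>
    have a1 := cheb_add_two (-(n : ℤ) - 1 + b)
    have a2 := cheb_add_two (-(n : ℤ) - 1)
    rw [show -(n : ℤ) - 1 + b + 2 = -n + 1 + b by ring,
      show -(n : ℤ) - 1 + b + 1 = -n + b by ring] at a1
    rw [show -(n : ℤ) - 1 + 2 = -n + 1 by ring, show -(n : ℤ) - 1 + 1 = -n by ring] at a2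
    have b1 := congrArg (Int.cast : ℤ → ZMod p) a1
    have b2 := congrArg (Int.cast : ℤ → ZMod p) a2
    push_cast at b1 b2 ih1 ih2 ⊢
    rw [ih1, ih2] at b1
    linear_combination b1 - b2

theorem IsPeriod.cheb_eq {p b : ℕ} (h : IsPeriod p b) {m : ℤ} {r : ℕ} (hm : (b : ℤ) ∣ m - r) :
    (cheb m : ZMod p) = (chebMod p 17 (r % b)).1 := by
  have hr : r % b < 2 ^ 17 := (Nat.mod_lt _ h.2.2.1).trans h.2.2.2.1
  rw [(chebMod_spec h.1.pos 17 _ hr).1]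
  obtain ⟨c, hc⟩ := hm
  refine Eq.trans ?_ (h.periodic.int_mul (c + r / b) (r % b : ℕ))
  congr 2
  have hd : (b : ℤ) * (r / b) + r % b = r := Int.mul_ediv_add_emod _ _
  push_cast
  linear_combination hc - hd

/-- Euler's criterion shows that `13 * cheb r + u p` is not a square modulo one of the primes
`p` in the list of pairs `(p, b)`, where `b` is a period of `cheb` modulo `p`. -/
def excluded (u : ℕ → ℕ) (L : List (ℕ × ℕ)) (r : ℕ) : Bool :=
  L.any fun pb => (13 * (chebMod pb.1 17 (r % pb.2)).1 + u pb.1) ^ (pb.1 / 2) % pb.1 == pb.1 - 1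

theorem not_isSquare_of_pow_eq_neg_one {p : ℕ} (hp : p.Prime) (h2 : p ≠ 2) {a : ZMod p}
    (ha : a ^ (p / 2) = -1) : ¬ IsSquare a := by
  have : Fact p.Prime := ⟨hp⟩
  have : Fact (2 < p) := ⟨lt_of_le_of_ne hp.two_le h2.symm⟩
  have hpos : p / 2 ≠ 0 := by have := hp.two_le; lia
  rintro ⟨s, rfl⟩
  have hs : s ≠ 0 := by
    rintro rfl
    simp [hpos] at ha
  exact ZMod.neg_one_ne_one (ha.symm.trans
    ((ZMod.euler_criterion p (mul_self_ne_zero.2 hs)).1 ⟨s, rfl⟩))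

/-- Lifting the residue class of a solution from modulus `M` to modulus `M * q`. -/
theorem exists_lift {d m z : ℤ} (hz : 16 * z ^ 2 = 13 * cheb m + d) {u : ℕ → ℕ}
    (hu : ∀ p, 0 < p → (u p : ZMod p) = d) {M q r : ℕ} (hq : 0 < q) (hm : (M : ℤ) ∣ m - r)
    {L : List (ℕ × ℕ)} (hL : ∀ pb ∈ L, IsPeriod pb.1 pb.2 ∧ pb.2 ∣ M * q) :
    ∃ i < q, (((M * q : ℕ) : ℤ) ∣ m - (r + M * i : ℕ)) ∧ excluded u L (r + M * i) = false := by
  obtain ⟨c, hc⟩ := hm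
  have hq' : (0 : ℤ) < q := by exact_mod_cast hq
  have hi := Int.toNat_of_nonneg (Int.emod_nonneg c hq'.ne')
  have hdvd : ((M * q : ℕ) : ℤ) ∣ m - (r + M * (c % q).toNat : ℕ) := by
    refine ⟨c / q, ?_⟩
    push_cast
    rw [hi]
    linear_combination hc - M * Int.mul_ediv_add_emod c q
  refine ⟨(c % q).toNat, ?_, hdvd, ?_⟩
  · have := Int.emod_lt_of_pos c hq'
    lia
  · rw [Bool.eq_false_iff]
    intro hex
    obtain ⟨⟨p, b⟩, hmem, ht⟩ := List.any_eq_true.1 hex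
    obtain ⟨hper, hb⟩ := hL _ hmem
    simp only [beq_iff_eq] at ht hper hb
    have hpos := hper.1.pos
    refine not_isSquare_of_pow_eq_neg_one hper.1 hper.2.1
      (a := ((13 * cheb m + d : ℤ) : ZMod p)) ?_ ⟨4 * z, ?_⟩
    · have h := congrArg (Nat.cast : ℕ → ZMod p) ht
      rw [ZMod.natCast_mod, Nat.cast_sub hpos] at h
      push_cast at h ⊢
      rw [hper.cheb_eq ((Int.natCast_dvd_natCast.2 hb).trans hdvd), ← hu p hpos, h]
      simp
    · rw [← hz]
      push_cast
      ring

theorem lucasU_six_one (m : ℕ) : 16 * lucasU 6 1 m ^ 2 + 1 = cheb m := by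
  suffices h : 16 * lucasU 6 1 m ^ 2 + 1 = cheb m ∧
      16 * lucasU 6 1 (m + 1) ^ 2 + 1 = cheb (m + 1) ∧
      lucasU 6 1 (m + 1) ^ 2 - 6 * lucasU 6 1 m * lucasU 6 1 (m + 1) + lucasU 6 1 m ^ 2 = 1 from h.1
  induction m with
  | zero => simp [lucasU, cheb_zero, cheb_one]
  | succ k ih =>
    obtain ⟨h1, h2, h3⟩ := ih
    push_cast
    refine ⟨h2, ?_, ?_⟩
    · rw [show (k + 1 + 1 : ℤ) = k + 2 by ring, cheb_add_two, lucasU]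
      linear_combination 34 * h2 - h1 + 32 * h3
    · rw [lucasU]
      linear_combination h3

theorem exists_sq_lucasU_three_neg_one (n : ℕ) :
    ∃ z : ℤ, z ^ 2 = 13 * lucasU 3 (-1) n ^ 2 + 4 * (-1) ^ n := by
  have h : lucasU 3 (-1) (n + 1) ^ 2 - 3 * lucasU 3 (-1) n * lucasU 3 (-1) (n + 1)
      - lucasU 3 (-1) n ^ 2 = (-1) ^ n := by
    induction n with
    | zero => simp [lucasU]
    | succ k ih =>
      rw [lucasU, pow_succ]
      linear_combination -ih
  exact ⟨2 * lucasU 3 (-1) (n + 1) - 3 * lucasU 3 (-1) n, by linear_combination 4 * h⟩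

theorem exists_cheb_natCast_eq (j : ℕ) :
    ∃ x : ℤ, cheb j = 16 * x ^ 2 + 1 := ⟨_, (lucasU_six_one j).symm⟩

/-- A solution with index in the class of `m₀` modulo `2 * j`, but not modulo `4 * j`, is
impossible when `cheb j` is a nonresidue. -/
theorem false_of_jacobiSym {d m z m₀ g : ℤ} (hz : 16 * z ^ 2 = 13 * cheb m + d) {N j : ℕ}
    (hN : Odd N) (hm : m = m₀ + 2 * j * g) (hg : Odd g) {ε : ℤ} (hε : ε = 2 ∨ ε = -2)
    (hA : -(13 * cheb m₀) + d = ε * N) (hJ : J(cheb j | N) = -1) : False := by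
  obtain ⟨x, hx⟩ := exists_cheb_natCast_eq j
  obtain ⟨k, hk⟩ := Int.eq_ofNat_of_zero_le (show 0 ≤ cheb j by rw [hx]; positivity)
  have hk8 : k % 8 = 1 := by
    have : (k : ℤ) = 16 * x ^ 2 + 1 := hk ▸ hx
    lia
  have hkodd : Odd k := Nat.odd_iff.2 (by lia)
  have hJε : J(ε | k) = 1 := by
    rcases hε with rfl | rfl
    · rw [jacobiSym.at_two hkodd, ZMod.χ₈_nat_mod_eight, hk8]
      decide
    · rw [jacobiSym.at_neg_two hkodd, ZMod.χ₈'_nat_eq_if_mod_eight, if_neg (by lia),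
        if_pos (Or.inl hk8)]
  have hneg : J(ε * N | k) = -1 := by
    rw [jacobiSym.mul_left, hJε, one_mul,
      jacobiSym.quadratic_reciprocity_one_mod_four' hN (by lia), ← hJ, hk]
  refine ZMod.nonsquare_of_jacobiSym_eq_neg_one hneg ⟨4 * z, ?_⟩
  have hdvd := cheb_dvd_add m₀ j hg
  rw [← hm, hk] at hdvd
  have h0 : ((cheb m + cheb m₀ : ℤ) : ZMod k) = 0 := (ZMod.intCast_zmod_eq_zero_iff_dvd _ _).2 hdvd
  rw [← hA]
  have hz' := congrArg (Int.cast : ℤ → ZMod k) hz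
  push_cast at hz' h0 ⊢
  linear_combination -hz' - 13 * h0

/-- If `ℓ` doublings of the index fix the residue of `cheb c` modulo `N`, then so do any multiple
of `ℓ` doublings. -/
theorem jacobiSym_cheb_two_pow_mul {N : ℕ} (hN : 0 < N) {ℓ c v : ℕ} (hc : c < 2 ^ 30)
    (hv : (chebMod N 30 c).1 = v)
    (hfix : (fun x => (2 * x * x + (N - 1)) % N)^[ℓ] v = v) (k : ℕ) :
    J(cheb (2 ^ (ℓ * k) * c : ℕ) | N) = J(v | N) := by
  have hpred : ((N - 1 : ℕ) : ZMod N) = -1 := by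
    rw [Nat.cast_sub hN]; simp
  have hdbl (i : ℕ) (a w : ℕ) (ha : (cheb a : ZMod N) = w) :
      (cheb (2 ^ i * a : ℕ) : ZMod N) = ((fun x => (2 * x * x + (N - 1)) % N)^[i] w : ℕ) := by
    induction i with
    | zero => simpa using ha
    | succ i ih =>
      rw [Function.iterate_succ_apply', pow_succ', mul_assoc, Nat.cast_mul 2, Nat.cast_ofNat,
        cheb_two_mul]
      push_cast
      rw [ZMod.natCast_mod]
      push_cast
      rw [hpred, ← ih]
      push_cast
      ring
  have h : (cheb (2 ^ (ℓ * k) * c : ℕ) : ZMod N) = v := by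
    induction k with
    | zero => simpa [hv] using (chebMod_spec hN 30 c hc).1.symm
    | succ k ih =>
      have := hdbl ℓ _ _ ih
      rw [hfix] at this
      rw [← this]
      congr 3
      ring
  rw [jacobiSym.mod_left (cheb _), jacobiSym.mod_left v]
  congr 1
  rw [← ZMod.intCast_eq_intCast_iff']
  exact_mod_cast h

theorem exists_two_pow_mul_odd {w : ℤ} (hw : w ≠ 0) : ∃ (s : ℕ) (u : ℤ), Odd u ∧ w = 2 ^ s * u := by
  obtain ⟨s, u, hu, h⟩ := Nat.exists_eq_two_pow_mul_odd (Int.natAbs_ne_zero.2 hw)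
  have hu' : Odd (u : ℤ) := by exact_mod_cast hu
  rcases Int.natAbs_eq w with h1 | h1 <;> rw [h] at h1 <;> push_cast at h1
  · exact ⟨s, u, hu', h1⟩
  · exact ⟨s, -u, hu'.neg, by rw [h1]; ring⟩

theorem eq_zero_of_sq_eq_add {m z : ℤ} (hz : 16 * z ^ 2 = 13 * cheb m + 51) : m = 0 := by
  have hu (p : ℕ) (_ : 0 < p) : (((fun _ => 51) p : ℕ) : ZMod p) = ((51 : ℤ) : ZMod p) := by simp
  obtain ⟨i, hi, hdvd, hex⟩ := exists_lift hz hu (M := 1) (q := 48) (r := 0)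
    (by decide) (by simp) (L := [(3, 2), (5, 3), (97, 24), (193, 48)]) (by
      intro pb hpb
      fin_cases hpb <;> exact ⟨⟨by norm_num, by decide +kernel⟩, by decide⟩)
  have hsurv : ∀ i < 48, excluded (fun _ => 51) [(3, 2), (5, 3), (97, 24), (193, 48)]
      (0 + 1 * i) = false → i = 0 := by decide +kernel
  obtain rfl := hsurv i hi hex
  obtain ⟨w, hw⟩ := hdvd
  by_contra hm
  obtain ⟨s, g, hg, rfl⟩ := exists_two_pow_mul_odd (w := w) (by rintro rfl; simp at hw; lia)
  have hA : -(13 * cheb 0) + 51 = 2 * (19 : ℕ) := by rw [cheb_zero]; norm_num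
  rcases Nat.even_or_odd' s with ⟨k, rfl | rfl⟩
  · refine false_of_jacobiSym hz (N := 19) (j := 2 ^ (2 * k) * 24)
      (by decide) ?_ hg (Or.inl rfl) hA ?_
    · push_cast at hw ⊢
      linear_combination hw
    · rw [jacobiSym_cheb_two_pow_mul (v := 2) (by decide) (by decide) (by decide +kernel)
        (by decide +kernel)]
      norm_num
  · refine false_of_jacobiSym hz (N := 19) (j := 2 ^ (2 * k) * 16) (by decide) ?_
      (Odd.mul (by decide : Odd (3 : ℤ)) hg) (Or.inl rfl) hA ?_
    · push_cast at hw ⊢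
      linear_combination hw
    · rw [jacobiSym_cheb_two_pow_mul (v := 2) (by decide) (by decide) (by decide +kernel)
        (by decide +kernel)]
      norm_num

theorem eq_one_of_sq_eq_sub {m z : ℤ} (hz : 16 * z ^ 2 = 13 * cheb m + -77) (hm : 48 ∣ m - 1) :
    m = 1 := by
  have hu (p : ℕ) (hp : 0 < p) :
      (((fun p => 77 * (p - 1)) p : ℕ) : ZMod p) = ((-77 : ℤ) : ZMod p) := by
    push_cast [Nat.cast_sub hp]
    simp
  obtain ⟨i, hi, hdvd, hex⟩ := exists_lift hz hu (M := 48) (q := 25) (r := 1)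
    (by decide) hm
    (L := [(151, 75), (149, 75), (401, 100), (751, 75), (1201, 75), (1601, 100)]) (by
      intro pb hpb
      fin_cases hpb <;> exact ⟨⟨by norm_num, by decide +kernel⟩, by decide⟩)
  obtain rfl := (by decide +kernel : ∀ i < 25, excluded (fun p => 77 * (p - 1))
      [(151, 75), (149, 75), (401, 100), (751, 75), (1201, 75), (1601, 100)]
      (1 + 48 * i) = false → i = 0) i hi hex
  obtain ⟨w, hw⟩ := hdvd
  by_contra hm1
  obtain ⟨s, g, hg, rfl⟩ := exists_two_pow_mul_odd (w := w) (by rintro rfl; simp at hw; lia)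
  refine false_of_jacobiSym hz (N := 149) (j := 2 ^ (1 * s) * 200) (m₀ := 1) (by decide) ?_
    (Odd.mul (by decide : Odd (3 : ℤ)) hg) (Or.inr rfl) (by rw [cheb_one]; norm_num) ?_
  · push_cast at hw ⊢
    linear_combination hw
  · rw [jacobiSym_cheb_two_pow_mul (v := 74) (by decide) (by decide) (by decide +kernel)
      (by decide +kernel)]
    norm_num

theorem cheb_five : cheb 5 = 22619537 := by
  have h2 := cheb_add_two 0
  have h3 := cheb_add_two 1
  have h4 := cheb_add_two 2
  have h5 := cheb_add_two 3
  norm_num [cheb_zero, cheb_one] at h2 h3 h4 h5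
  lia

theorem eq_five_of_sq_eq_sub {m z : ℤ} (hz : 16 * z ^ 2 = 13 * cheb m + -77) (hm : 48 ∣ m - 5) :
    m = 5 := by
  have hu (p : ℕ) (hp : 0 < p) :
      (((fun p => 77 * (p - 1)) p : ℕ) : ZMod p) = ((-77 : ℤ) : ZMod p) := by
    push_cast [Nat.cast_sub hp]
    simp
  obtain ⟨i, hi, hdvd, hex⟩ := exists_lift hz hu (M := 48) (q := 5) (r := 5)
    (by decide) hm
    (L := [(19, 10), (31, 15), (241, 20)]) (by
      intro pb hpb
      fin_cases hpb <;> exact ⟨⟨by norm_num, by decide +kernel⟩, by decide⟩)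
  obtain rfl := (by decide +kernel : ∀ i < 5, excluded (fun p => 77 * (p - 1))
      [(19, 10), (31, 15), (241, 20)]
      (5 + 48 * i) = false → i = 0) i hi hex
  obtain ⟨i, hi, hdvd, hex⟩ := exists_lift hz hu (M := 240) (q := 23) (r := 5)
    (by decide) hdvd
    (L := [(47, 23), (229, 23), (827, 138), (1151, 115), (26497, 92)]) (by
      intro pb hpb
      fin_cases hpb <;> exact ⟨⟨by norm_num, by decide +kernel⟩, by decide⟩)
  obtain rfl := (by decide +kernel : ∀ i < 23, excluded (fun p => 77 * (p - 1))
      [(47, 23), (229, 23), (827, 138), (1151, 115), (26497, 92)]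
      (5 + 240 * i) = false → i = 0) i hi hex
  obtain ⟨i, hi, hdvd, hex⟩ := exists_lift hz hu (M := 5520) (q := 211) (r := 5)
    (by decide) hdvd
    (L := [(421, 211), (2111, 211), (2531, 1266), (4219, 2110), (12659, 6330), (15193, 1266),
        (94951, 3165), (126601, 6330)]) (by
      intro pb hpb
      fin_cases hpb <;> exact ⟨⟨by norm_num, by decide +kernel⟩, by decide⟩)
  obtain rfl := (by decide +kernel : ∀ i < 211, excluded (fun p => 77 * (p - 1))
      [(421, 211), (2111, 211), (2531, 1266), (4219, 2110), (12659, 6330), (15193, 1266),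
        (94951, 3165), (126601, 6330)]
      (5 + 5520 * i) = false → i = 0) i hi hex
  obtain ⟨i, hi, hdvd, hex⟩ := exists_lift hz hu (M := 1164720) (q := 271) (r := 5)
    (by decide) hdvd
    (L := [(541, 271), (2711, 1355), (3251, 1626), (4337, 1084), (5419, 542), (13009, 3252),
        (26017, 6504), (37397, 18699), (81299, 542), (153929, 542)]) (by
      intro pb hpb
      fin_cases hpb <;> exact ⟨⟨by norm_num, by decide +kernel⟩, by decide⟩)
  obtain rfl := (by decide +kernel : ∀ i < 271, excluded (fun p => 77 * (p - 1))
      [(541, 271), (2711, 1355), (3251, 1626), (4337, 1084), (5419, 542), (13009, 3252),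
        (26017, 6504), (37397, 18699), (81299, 542), (153929, 542)]
      (5 + 1164720 * i) = false → i = 0) i hi hex
  obtain ⟨w, hw⟩ := hdvd
  by_contra hm5
  obtain ⟨s, g, hg, rfl⟩ := exists_two_pow_mul_odd (w := w) (by rintro rfl; simp at hw; lia)
  have hA : -(13 * cheb 5) + -77 = -2 * (147027029 : ℕ) := by rw [cheb_five]; norm_num
  obtain ⟨k, hk⟩ : ∃ k, s = 3 * k ∨ s = 3 * k + 1 ∨ s = 3 * k + 2 := ⟨s / 3, by lia⟩
  rcases hk with rfl | rfl | rfl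
  · refine false_of_jacobiSym hz (N := 147027029) (j := 2 ^ (3 * k) * 10521304)
      (by decide) ?_
      (Odd.mul (by decide : Odd (15 : ℤ)) hg) (Or.inr rfl) hA ?_
    · push_cast at hw ⊢
      linear_combination hw
    · rw [jacobiSym_cheb_two_pow_mul (v := 113525605) (by decide) (by decide) (by decide +kernel)
        (by decide +kernel)]
      norm_num
  · refine false_of_jacobiSym hz (N := 147027029) (j := 2 ^ (3 * k) * 21042608)
      (by decide) ?_
      (Odd.mul (by decide : Odd (15 : ℤ)) hg) (Or.inr rfl) hA ?_
    · push_cast at hw ⊢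
      linear_combination hw
    · rw [jacobiSym_cheb_two_pow_mul (v := 56960809) (by decide) (by decide) (by decide +kernel)
        (by decide +kernel)]
      norm_num
  · refine false_of_jacobiSym hz (N := 147027029) (j := 2 ^ (3 * k) * 210426080)
      (by decide) ?_
      (Odd.mul (by decide : Odd (3 : ℤ)) hg) (Or.inr rfl) hA ?_
    · push_cast at hw ⊢
      linear_combination hw
    · rw [jacobiSym_cheb_two_pow_mul (v := 113525605) (by decide) (by decide) (by decide +kernel)
        (by decide +kernel)]
      norm_num

theorem mem_of_sq_eq_sub {m z : ℤ} (hz : 16 * z ^ 2 = 13 * cheb m + -77) :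
    m = 1 ∨ m = 5 ∨ m = -5 ∨ m = -1 := by
  have hu (p : ℕ) (hp : 0 < p) :
      (((fun p => 77 * (p - 1)) p : ℕ) : ZMod p) = ((-77 : ℤ) : ZMod p) := by
    push_cast [Nat.cast_sub hp]
    simp
  obtain ⟨i, hi, hdvd, hex⟩ := exists_lift hz hu (M := 1) (q := 48) (r := 0)
    (by decide) (by simp) (L := [(3, 2), (7, 3), (97, 24), (193, 48)]) (by
      intro pb hpb
      fin_cases hpb <;> exact ⟨⟨by norm_num, by decide +kernel⟩, by decide⟩)
  have hi' := (by decide +kernel : ∀ i < 48, excluded (fun p => 77 * (p - 1))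
      [(3, 2), (7, 3), (97, 24), (193, 48)] (0 + 1 * i) = false →
      i = 1 ∨ i = 5 ∨ i = 43 ∨ i = 47) i hi hex
  push_cast at hdvd
  have hz' : 16 * z ^ 2 = 13 * cheb (-m) + -77 := by rw [cheb_neg, hz]
  rcases hi' with rfl | rfl | rfl | rfl
  · exact Or.inl (eq_one_of_sq_eq_sub hz (by lia))
  · exact Or.inr (Or.inl (eq_five_of_sq_eq_sub hz (by lia)))
  · have := eq_five_of_sq_eq_sub hz' (by lia)
    lia
  · have := eq_one_of_sq_eq_sub hz' (by lia)
    lia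

theorem U3neg1_inter_U6_1 :
    {x : ℤ | ∃ n : ℕ, x = lucasU 3 (-1) n} ∩ {x : ℤ | ∃ m : ℕ, x = lucasU 6 1 m} =
      ({0, 1, 1189} : Set ℤ) := by
  ext x
  simp only [Set.mem_inter_iff, Set.mem_ofPred_eq, Set.mem_insert_iff, Set.mem_singleton_iff]
  constructor
  · rintro ⟨⟨n, hn⟩, m, rfl⟩
    obtain ⟨z, hz⟩ := exists_sq_lucasU_three_neg_one n
    have hm := lucasU_six_one m
    rw [← hn] at hz
    rcases Nat.even_or_odd n with he | ho
    · rw [he.neg_one_pow] at hz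
      have h0 : (m : ℤ) = 0 := eq_zero_of_sq_eq_add (z := z)
        (by linear_combination 16 * hz + 13 * hm)
      obtain rfl : m = 0 := by lia
      simp [lucasU]
    · rw [ho.neg_one_pow] at hz
      have h1 := mem_of_sq_eq_sub (m := m) (z := z) (by linear_combination 16 * hz + 13 * hm)
      obtain rfl | rfl : m = 1 ∨ m = 5 := by lia
      · simp [lucasU]
      · norm_num [lucasU]
  · rintro (rfl | rfl | rfl)
    · exact ⟨⟨0, rfl⟩, 0, rfl⟩
    · exact ⟨⟨1, rfl⟩, 1, rfl⟩
    · exact ⟨⟨7, rfl⟩, 5, rfl⟩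
end

section
/- The intersection of the Fibonacci numbers and the Pell-Lucas numbers is {2, 34}; that is, {U_n(1,-1) : n >= 0} ∩ {V_m(2,-1) : m >= 0} = {2, 34}. -/
/-- The integer Lucas number `L n`, expressed through Fibonacci numbers. -/
def lucasNum (n : ℕ) : ℤ := 2 * Nat.fib (n + 1) - Nat.fib n

theorem lucasU_one_neg_one (n : ℕ) : lucasU 1 (-1) n = Nat.fib n := by
  induction n using Nat.twoStepInduction with
  | zero => simp [lucasU]
  | one => simp [lucasU]
  | more n h₁ h₂ => rw [lucasU, h₁, h₂, Nat.fib_add_two]; push_cast; ring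

theorem two_mul_fib_add (a b : ℕ) :
    2 * (Nat.fib (a + b) : ℤ) = Nat.fib a * lucasNum b + lucasNum a * Nat.fib b := by
  induction b using Nat.twoStepInduction with
  | zero => simp [lucasNum]; ring
  | one => simp [lucasNum]
  | more b h₁ h₂ =>
    rw [← add_assoc, Nat.fib_add_two]
    simp only [lucasNum, ← add_assoc, Nat.fib_add_two] at *
    push_cast at *
    linarith

theorem two_mul_lucasNum_add (a b : ℕ) :
    2 * lucasNum (a + b) = lucasNum a * lucasNum b + 5 * Nat.fib a * Nat.fib b := by
  have h₁ := two_mul_fib_add a b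
  have h₂ := two_mul_fib_add a (b + 1)
  simp only [lucasNum, ← add_assoc, Nat.fib_add_two] at *
  push_cast at *
  linarith

theorem lucasNum_sq (n : ℕ) : lucasNum n ^ 2 = 5 * (Nat.fib n : ℤ) ^ 2 + 4 * (-1) ^ n := by
  induction n with
  | zero => simp [lucasNum]
  | succ n ih =>
    simp only [lucasNum, Nat.fib_add_two] at *
    push_cast
    rw [pow_succ]
    linear_combination -ih

theorem fib_two_mul_eq (n : ℕ) : (Nat.fib (2 * n) : ℤ) = Nat.fib n * lucasNum n := by
  have := two_mul_fib_add n n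
  rw [two_mul n]
  linarith

theorem lucasNum_two_mul {n : ℕ} (hn : Even n) : lucasNum (2 * n) = lucasNum n ^ 2 - 2 := by
  have h₁ := two_mul_lucasNum_add n n
  have h₂ := lucasNum_sq n
  rw [hn.neg_one_pow] at h₂
  rw [two_mul n]
  linarith

theorem dvd_lucasNum_mul_odd {d : ℤ} (hd : IsCoprime d 2) {k : ℕ} (hk : d ∣ lucasNum k)
    (j : ℕ) : d ∣ lucasNum (k * (2 * j + 1)) := by
  induction j with
  | zero => simpa using hk
  | succ j ih =>
    refine hd.dvd_of_dvd_mul_left ?_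
    rw [show k * (2 * (j + 1) + 1) = k * (2 * j + 1) + 2 * k by ring, two_mul_lucasNum_add,
      fib_two_mul_eq]
    exact dvd_add (ih.mul_right _) ((hk.mul_left _).mul_left _)

theorem lucasNum_two_pow (i : ℕ) :
    ∃ d : ℕ, (d % 120 = 7 ∨ d % 120 = 47) ∧ (d : ℤ) = lucasNum (2 ^ (i + 2)) := by
  induction i with
  | zero => exact ⟨7, by norm_num, by simp [lucasNum, Nat.fib_add_two]⟩
  | succ i ih =>
    obtain ⟨d, hd, h⟩ := ih
    have hd2 : 2 ≤ d ^ 2 := by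
      have : 2 ≤ d := by omega
      nlinarith
    refine ⟨d ^ 2 - 2, ?_, ?_⟩
    · have : d ^ 2 % 120 = 49 := by rcases hd with hd | hd <;> simp [Nat.pow_mod, hd]
      omega
    · rw [show 2 ^ (i + 1 + 2) = 2 * 2 ^ (i + 2) by ring,
        lucasNum_two_mul (even_two.pow_of_ne_zero (by omega)), ← h]
      push_cast [hd2]
      rfl

theorem isCoprime_of_mod {d : ℕ} (hd : d % 120 = 7 ∨ d % 120 = 47) {a : ℤ}
    (ha : a = 2 ∨ a = 6) : IsCoprime (d : ℤ) a := by
  have h₂ : IsCoprime (d : ℤ) 2 := by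
    rw [← Nat.cast_ofNat (n := 2), Nat.isCoprime_iff_coprime, Nat.coprime_comm,
      Nat.Prime.coprime_iff_not_dvd Nat.prime_two]
    omega
  have h₃ : IsCoprime (d : ℤ) 3 := by
    rw [← Nat.cast_ofNat (n := 3), Nat.isCoprime_iff_coprime, Nat.coprime_comm,
      Nat.Prime.coprime_iff_not_dvd Nat.prime_three]
    omega
  rcases ha with rfl | rfl
  · exact h₂
  · exact h₂.mul_right h₃

theorem exists_dvd_lucasNum {N : ℕ} (hN : N ≠ 0) (h4 : 4 ∣ N) :
    ∃ d : ℕ, (d % 120 = 7 ∨ d % 120 = 47) ∧ (d : ℤ) ∣ lucasNum N := by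
  obtain ⟨i, g, ⟨j, rfl⟩, rfl⟩ := Nat.exists_eq_two_pow_mul_odd hN
  have hi : 2 ≤ i := by
    by_contra! hi
    interval_cases i <;> omega
  obtain ⟨i, rfl⟩ := Nat.exists_eq_add_of_le' hi
  obtain ⟨d, hd, h⟩ := lucasNum_two_pow i
  exact ⟨d, hd, dvd_lucasNum_mul_odd (isCoprime_of_mod hd (.inl rfl)) (by rw [h]) j⟩

theorem jacobiSym_values {d : ℕ} (hd : d % 120 = 7 ∨ d % 120 = 47) :
    jacobiSym (-1) d = -1 ∧ jacobiSym 2 d = 1 ∧ jacobiSym 5 d = -1 := by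
  have hodd : Odd d := Nat.odd_iff.2 (by omega)
  refine ⟨?_, ?_, ?_⟩
  · rw [jacobiSym.at_neg_one hodd, ZMod.χ₄_nat_three_mod_four (by omega)]
  · rw [jacobiSym.at_two hodd, ZMod.χ₈_nat_mod_eight, show d % 8 = 7 by omega]
    decide
  · have := jacobiSym.quadratic_reciprocity_one_mod_four (a := 5) (b := d) (by norm_num) hodd
    rw [Nat.cast_ofNat] at this
    rw [this, jacobiSym.mod_left, show ((d : ℤ) % (5 : ℕ)) = 2 by omega,
      jacobiSym.at_two (by decide)]
    decide

theorem jacobiSym_eq_of_dvd_sub {d : ℕ} {a b : ℤ} (h : (d : ℤ) ∣ a - b) :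
    jacobiSym a d = jacobiSym b d := by
  rw [jacobiSym.mod_left a, jacobiSym.mod_left b,
    Int.emod_eq_emod_iff_emod_sub_eq_zero.2 (Int.emod_eq_zero_of_dvd h)]

theorem not_dvd_ten_mul_sq_sub_one {d : ℕ} (hd : d % 120 = 7 ∨ d % 120 = 47) (y : ℤ) :
    ¬ (d : ℤ) ∣ 10 * y ^ 2 - 1 := by
  intro h
  have := jacobiSym_eq_of_dvd_sub h
  obtain ⟨-, h2, h5⟩ := jacobiSym_values hd
  rw [show (10 : ℤ) = 2 * 5 by norm_num, jacobiSym.mul_left, jacobiSym.mul_left,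
    jacobiSym.pow_left, h2, h5, jacobiSym.one_left] at this
  nlinarith [sq_nonneg (jacobiSym y d)]

theorem not_dvd_mul_sq_add_sq {d : ℕ} (hd : d % 120 = 7 ∨ d % 120 = 47) {c s : ℤ}
    (hc : c = 2 ∨ c = 6) (hs : s = 1 ∨ s = 8) (x : ℤ) : ¬ (d : ℤ) ∣ s * x ^ 2 + c ^ 2 := by
  intro h
  have := jacobiSym_eq_of_dvd_sub (a := s * x ^ 2) (b := -1 * c ^ 2) (by simpa using h)
  obtain ⟨h1, h2, -⟩ := jacobiSym_values hd
  have hs1 : jacobiSym s d = 1 := by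
    rcases hs with rfl | rfl
    · exact jacobiSym.one_left d
    · rw [show (8 : ℤ) = 2 ^ 3 by norm_num, jacobiSym.pow_left, h2, one_pow]
  have hc1 : jacobiSym c d ^ 2 = 1 :=
    jacobiSym.sq_one (Int.isCoprime_iff_gcd_eq_one.1 (isCoprime_of_mod hd hc).symm)
  rw [jacobiSym.mul_left, jacobiSym.mul_left, jacobiSym.pow_left, jacobiSym.pow_left, h1, hs1,
    hc1] at this
  nlinarith [sq_nonneg (jacobiSym x d)]

theorem dvd_fib_two_mul_of_dvd_lucasNum {d : ℕ} (hd : d % 120 = 7 ∨ d % 120 = 47)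
    {N : ℕ} (hN : Even N)
    (h : (d : ℤ) ∣ lucasNum N) :
    (d : ℤ) ∣ Nat.fib (2 * N) ∧ (d : ℤ) ∣ Nat.fib (2 * N + 1) + 1 := by
  have h0 : (d : ℤ) ∣ Nat.fib (2 * N) := by
    rw [fib_two_mul_eq]
    exact h.mul_left _
  refine ⟨h0, (isCoprime_of_mod hd (.inl rfl)).dvd_of_dvd_mul_left ?_⟩
  have h1 := lucasNum_two_mul hN
  rw [lucasNum] at h1
  rw [show 2 * ((Nat.fib (2 * N + 1) : ℤ) + 1) = Nat.fib (2 * N) + lucasNum N ^ 2 by linarith]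
  exact dvd_add h0 (h.pow two_ne_zero)

theorem eq_three_of_fib_sq_add_four {n : ℕ} (hn : Odd n) {y : ℤ}
    (h : (Nat.fib n : ℤ) ^ 2 + 4 = 8 * y ^ 2) : n = 3 := by
  by_contra hne
  obtain ⟨N, hN0, hN4, hN⟩ : ∃ N, N ≠ 0 ∧ 4 ∣ N ∧ (n = N + 3 ∨ N = n + 3) := by
    have := Nat.odd_iff.1 hn
    by_cases h3 : n % 4 = 3
    · exact ⟨n - 3, by omega, by omega, by omega⟩
    · exact ⟨n + 3, by omega, by omega, by omega⟩
  obtain ⟨d, hd, hdvd⟩ := exists_dvd_lucasNum hN0 hN4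
  have hsq := lucasNum_sq N
  rw [(even_iff_two_dvd.2 (by omega : 2 ∣ N)).neg_one_pow] at hsq
  have key : ∃ c, (Nat.fib n : ℤ) ^ 2 = 4 * (Nat.fib N : ℤ) ^ 2 + lucasNum N * c := by
    rcases hN with rfl | rfl
    · refine ⟨lucasNum N + 4 * Nat.fib N, ?_⟩
      have : (Nat.fib (N + 3) : ℤ) = lucasNum N + 2 * Nat.fib N := by
        simp only [lucasNum, Nat.fib_add_two]
        push_cast
        ring
      rw [this]
      ring
    · refine ⟨lucasNum (n + 3) - 4 * Nat.fib (n + 3), ?_⟩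
      have : (Nat.fib n : ℤ) = lucasNum (n + 3) - 2 * Nat.fib (n + 3) := by
        simp only [lucasNum, Nat.fib_add_two]
        push_cast
        ring
      rw [this]
      ring
  obtain ⟨c, hc⟩ := key
  have h2 := isCoprime_of_mod hd (.inl rfl)
  refine not_dvd_ten_mul_sq_sub_one hd y (h2.dvd_of_dvd_mul_left (h2.dvd_of_dvd_mul_left ?_))
  rw [show 2 * (2 * (10 * y ^ 2 - 1)) = lucasNum N * (4 * lucasNum N + 5 * c) by linarith]
  exact hdvd.mul_right _

theorem fib_mod_of_period {M p : ℕ} (h₀ : Nat.fib p % M = 0 % M)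
    (h₁ : Nat.fib (p + 1) % M = 1 % M) (n : ℕ) : Nat.fib n % M = Nat.fib (n % p) % M := by
  have step (k : ℕ) : Nat.fib (k + p) ≡ Nat.fib k [MOD M] := by
    induction k using Nat.twoStepInduction with
    | zero => simpa using show Nat.fib p ≡ 0 [MOD M] from h₀
    | one => simpa [add_comm] using show Nat.fib (p + 1) ≡ 1 [MOD M] from h₁
    | more k ih₁ ih₂ =>
      rw [show k + 2 + p = k + p + 2 by ring, Nat.fib_add_two, Nat.fib_add_two]
      exact ih₁.add (by rwa [show k + p + 1 = k + 1 + p by ring])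
  have mul (r q : ℕ) : Nat.fib (r + p * q) ≡ Nat.fib r [MOD M] := by
    induction q with
    | zero => rfl
    | succ q ih =>
      rw [mul_add_one, ← add_assoc]
      exact (step _).trans ih
  conv_lhs => rw [← Nat.mod_add_div n p]
  exact mul _ _

theorem mod_six_of_fib_mod_four {n : ℕ} (h : Nat.fib n % 4 = 2) : n % 6 = 3 := by
  rw [fib_mod_of_period (p := 6) (by decide) (by decide)] at h
  have : n % 6 < 6 := Nat.mod_lt _ (by norm_num)
  interval_cases n % 6 <;> simp_all [Nat.fib_add_two]

theorem not_fib_mod_sub_two {n : ℕ} (hn : n % 48 = 15 ∨ n % 48 = 33) {s : ℤ}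
    (hs : s = 1 ∨ s = 8) (x : ℤ) : (Nat.fib n : ℤ) - 2 ≠ s * x ^ 2 := by
  intro h
  have h₁ : Nat.fib n % 23 = 12 := by
    rw [fib_mod_of_period (p := 48) (by norm_num) (by norm_num)]
    rcases hn with hn | hn <;> rw [hn] <;> norm_num
  have h₂ : ((s : ZMod 23)) * (x : ZMod 23) ^ 2 = 10 := by
    have h₃ : ((Nat.fib n : ℕ) : ZMod 23) = (12 : ℕ) := by
      rw [ZMod.natCast_eq_natCast_iff]
      exact h₁
    have h₄ := congrArg (Int.cast : ℤ → ZMod 23) h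
    push_cast at h₄
    rw [← h₄, h₃]
    decide
  generalize (x : ZMod 23) = z at h₂
  rcases hs with rfl | rfl <;> revert z <;> decide

theorem fib_sub_two_eq {n : ℕ} (hn : n % 6 = 3) {s x : ℤ} (hs : s = 1 ∨ s = 8)
    (h : (Nat.fib n : ℤ) - 2 = s * x ^ 2) : n = 3 ∨ n = 9 := by
  by_contra! hne
  by_cases h15 : n % 48 = 15 ∨ n % 48 = 33
  · exact not_fib_mod_sub_two h15 hs x h
  obtain ⟨N, hN0, hN4, hN⟩ : ∃ N, N ≠ 0 ∧ 4 ∣ N ∧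
      (n = 2 * N + 3 ∨ 2 * N = n + 3 ∨ n = 2 * N + 9 ∨ 2 * N = n + 9) := by
    have : n % 8 = 3 ∨ n % 8 = 5 ∨ n % 16 = 9 ∨ n % 16 = 7 := by omega
    rcases this with h | h | h | h
    · exact ⟨(n - 3) / 2, by omega, by omega, by omega⟩
    · exact ⟨(n + 3) / 2, by omega, by omega, by omega⟩
    · exact ⟨(n - 9) / 2, by omega, by omega, by omega⟩
    · exact ⟨(n + 9) / 2, by omega, by omega, by omega⟩
  obtain ⟨d, hd, hdvd⟩ := exists_dvd_lucasNum hN0 hN4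
  obtain ⟨⟨a, ha⟩, ⟨b, hb⟩⟩ :=
    dvd_fib_two_mul_of_dvd_lucasNum hd (even_iff_two_dvd.2 (by omega : 2 ∣ N)) hdvd
  rcases hN with hN | hN | hN | hN
  · refine not_dvd_mul_sq_add_sq hd (.inl rfl) hs x ⟨a + 2 * b, ?_⟩
    rw [hN] at h
    simp only [Nat.fib_add_two] at h
    push_cast at h
    linarith
  · refine not_dvd_mul_sq_add_sq hd (.inl rfl) hs x ⟨2 * b - 3 * a, ?_⟩
    rw [hN] at ha hb
    simp only [Nat.fib_add_two] at ha hb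
    push_cast at ha hb
    linarith
  · refine not_dvd_mul_sq_add_sq hd (.inr rfl) hs x ⟨21 * a + 34 * b, ?_⟩
    rw [hN] at h
    simp only [Nat.fib_add_two] at h
    push_cast at h
    linarith
  · refine not_dvd_mul_sq_add_sq hd (.inr rfl) hs x ⟨34 * b - 55 * a, ?_⟩
    rw [hN] at ha hb
    simp only [Nat.fib_add_two] at ha hb
    push_cast at ha hb
    linarith

theorem lucasV_two_neg_one (m : ℕ) :
    lucasV 2 (-1) m = 2 * (lucasU 2 (-1) (m + 1) - lucasU 2 (-1) m) := by
  induction m using Nat.twoStepInduction with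
  | zero => simp [lucasU, lucasV]
  | one => simp [lucasU, lucasV]
  | more m h₁ h₂ => simp only [lucasU, lucasV] at *; linarith

theorem lucasV_sq (m : ℕ) :
    lucasV 2 (-1) m ^ 2 = 8 * lucasU 2 (-1) m ^ 2 + 4 * (-1) ^ m := by
  rw [lucasV_two_neg_one]
  induction m with
  | zero => simp [lucasU]
  | succ m ih =>
    rw [lucasU, pow_succ (-1 : ℤ)]
    linear_combination -ih

theorem lucasV_two_mul (j : ℕ) :
    lucasV 2 (-1) (2 * j) = 8 * lucasU 2 (-1) j ^ 2 + 2 * (-1) ^ j := by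
  have key : lucasV 2 (-1) (2 * j) =
        2 * (lucasU 2 (-1) (j + 1) - lucasU 2 (-1) j) ^ 2 + 4 * lucasU 2 (-1) j ^ 2 ∧
      lucasV 2 (-1) (2 * j + 1) =
        2 * (lucasU 2 (-1) (j + 1) - lucasU 2 (-1) j) ^ 2 + 4 * lucasU 2 (-1) j ^ 2 +
          8 * lucasU 2 (-1) j * (lucasU 2 (-1) (j + 1) - lucasU 2 (-1) j) := by
    induction j with
    | zero => simp [lucasU, lucasV]
    | succ j ih =>
      obtain ⟨h₁, h₂⟩ := ih
      rw [show 2 * (j + 1) = 2 * j + 2 by ring]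
      simp only [lucasU, lucasV, h₁, h₂]
      constructor <;> ring
  have h := lucasV_sq j
  rw [lucasV_two_neg_one] at h
  linarith [key.1]

theorem lucasV_mod_four (m : ℕ) : lucasV 2 (-1) m % 4 = 2 := by
  induction m using Nat.twoStepInduction with
  | zero => simp [lucasV]
  | one => simp [lucasV]
  | more m h₁ h₂ => rw [lucasV]; omega

theorem eq_three_or_nine_of_fib_eq_lucasV {n m : ℕ}
    (h : (Nat.fib n : ℤ) = lucasV 2 (-1) m) : n = 3 ∨ n = 9 := by
  have hn : n % 6 = 3 := mod_six_of_fib_mod_four (by have := lucasV_mod_four m; omega)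
  rcases Nat.even_or_odd' m with ⟨j, rfl | rfl⟩
  · have h₁ := lucasV_two_mul j
    have h₂ := lucasV_sq j
    rcases Nat.even_or_odd j with hj | hj
    · rw [hj.neg_one_pow] at h₁
      exact fib_sub_two_eq hn (.inr rfl) (x := lucasU 2 (-1) j) (by linarith)
    · rw [hj.neg_one_pow] at h₁ h₂
      exact fib_sub_two_eq hn (.inl rfl) (x := lucasV 2 (-1) j) (by linarith)
  · have h₂ := lucasV_sq (2 * j + 1)
    rw [← h, (odd_two_mul_add_one j).neg_one_pow] at h₂
    exact .inl (eq_three_of_fib_sq_add_four (Nat.odd_iff.2 (by omega))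
      (y := lucasU 2 (-1) (2 * j + 1)) (by linarith))

theorem fibonacci_inter_pellLucas :
    {x : ℤ | ∃ n : ℕ, x = lucasU 1 (-1) n} ∩ {x : ℤ | ∃ m : ℕ, x = lucasV 2 (-1) m} =
      ({2, 34} : Set ℤ) := by
  ext x
  simp only [Set.mem_inter_iff, Set.mem_ofPred_eq, Set.mem_insert_iff, Set.mem_singleton_iff,
    lucasU_one_neg_one]
  constructor
  · rintro ⟨⟨n, rfl⟩, m, hm⟩
    rcases eq_three_or_nine_of_fib_eq_lucasV hm with rfl | rfl
    · exact .inl rfl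
    · exact .inr rfl
  · rintro (rfl | rfl)
    · exact ⟨⟨3, rfl⟩, 0, rfl⟩
    · exact ⟨⟨9, rfl⟩, 4, rfl⟩
end
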